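/- In any execution of the algorithm MaxMatch, the matched vertices execute the Update rule at most Δ(σ + 6μ) + μ times in total. -/

import Mathlib

open Classical

section MaxMatchPreamble

variable {V : Type*} [Fintype V] [LinearOrder V]

/-- Strict comparison on identifiers where `none` (null) counts as greater
than every identifier. -/
def optLT : Option V → Option V → Prop
  | some x, some y => x < y
  | some _, none => True
  | none, _ => False

/-- A configuration of the MaxMatch algorithm: the variables `p`, `α`, `β`
(`a`,`b` here) and the booleans `s`, `end` (`e` here) of every vertex. -/
structure MMConfig (V : Type*) where
  p : V → Option V
  a : V → Option V
  b : V → Option V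
  s : V → Bool
  e : V → Bool

/-- The local state of one vertex. -/
structure MMLocal (V : Type*) where
  p : Option V
  a : Option V
  b : Option V
  s : Bool
  e : Bool

/-- The local state of vertex `u` in configuration `C`. -/
def MMConfig.loc (C : MMConfig V) (u : V) : MMLocal V :=
  ⟨C.p u, C.a u, C.b u, C.s u, C.e u⟩

/-- `m` encodes a maximal matching of `G`: `m u = some v` iff `(u,v)` is a
matching edge, `m u = none` iff `u` is single. -/
structure MaxMatchingOn (G : SimpleGraph V) (m : V → Option V) : Prop where
  adj : ∀ u v, m u = some v → G.Adj u v
  symm : ∀ u v, m u = some v → m v = some u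
  maximal : ∀ u v, G.Adj u v → m u ≠ none ∨ m v ≠ none

/-- `Lowest(S)`: the minimum-identifier element of `S`, `none` if `S = ∅`. -/
noncomputable def lowestSet (S : Set V) : Option V :=
  if h : (Finset.univ.filter fun x => x ∈ S).Nonempty
  then some ((Finset.univ.filter fun x => x ∈ S).min' h) else none

/-- `Lowest` of a finite set of identifiers-or-null: `none` (null) elements are
greater than all identifiers, hence ignored. -/
noncomputable def lowestOpt (S : Finset (Option V)) : Option V :=
  lowestSet {x : V | some x ∈ S}

/-- Truth value of a proposition. -/
noncomputable def pb (P : Prop) : Bool := if P then true else false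

variable (G : SimpleGraph V) (m : V → Option V)

/-- The candidate set considered by `BestRematch(u)`. -/
def candSet (C : MMConfig V) (u : V) : Set V :=
  {x | G.Adj u x ∧ m x = none ∧ (C.p x = some u ∨ C.e x = false)}

/-- `BestRematch(u)`. -/
noncomputable def bestRematch (C : MMConfig V) (u : V) : Option V × Option V :=
  let a := lowestSet (candSet G m C u)
  (a, a.elim none fun w => lowestSet (candSet G m C u \ {w}))

/-- `AskFirst(u)`. -/
noncomputable def askFirst (C : MMConfig V) (u : V) : Option V :=
  match m u with
  | none => none
  | some v =>
      if C.a u ≠ none ∧ C.a v ≠ none ∧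
         2 ≤ ({C.a u, C.b u, C.a v, C.b v} : Finset (Option V)).card ∧
         (optLT (C.a u) (C.a v) ∨ (C.a u = C.a v ∧ C.b u = none) ∨
          (C.a u = C.a v ∧ C.b v ≠ none ∧ u < v))
      then C.a u else none

/-- `AskSecond(u)`. -/
noncomputable def askSecond (C : MMConfig V) (u : V) : Option V :=
  match m u with
  | none => none
  | some v =>
      if askFirst m C v ≠ none
      then lowestOpt (({C.a u, C.b u} : Finset (Option V)) \ {C.a v})
      else none

/-- `Ask(u)`. -/
noncomputable def ask (C : MMConfig V) (u : V) : Option V :=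
  if askFirst m C u = none then askSecond m C u else askFirst m C u

/-- Guard of rule `ResetEnd` (single vertices). -/
def guardResetEnd (C : MMConfig V) (x : V) : Prop :=
  C.p x = none ∧ C.e x = true

/-- Guard of rule `UpdateP` (single vertices). -/
def guardUpdateP (C : MMConfig V) (x : V) : Prop :=
  (C.p x = none ∧ ∃ w, G.Adj x w ∧ m w ≠ none ∧ C.p w = some x) ∨
  (∃ w, C.p x = some w ∧ ¬ (G.Adj x w ∧ m w ≠ none)) ∨
  (∃ w, C.p x = some w ∧ C.p w ≠ some x)

/-- Guard of rule `UpdateEnd` (single vertices). -/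
def guardUpdateEnd (C : MMConfig V) (x : V) : Prop :=
  ∃ w, C.p x = some w ∧ G.Adj x w ∧ m w ≠ none ∧ C.p w = some x ∧ C.e x ≠ C.e w

/-- `o ∈ single(N(u)) ∪ {null}`. -/
def inSNopt (u : V) (o : Option V) : Prop :=
  o = none ∨ ∃ w, o = some w ∧ G.Adj u w ∧ m w = none

/-- First part (first four disjuncts) of the guard of rule `Update`. -/
def guardUpdateA (C : MMConfig V) (u : V) : Prop :=
  optLT (C.b u) (C.a u) ∨
  (¬ inSNopt G m u (C.a u) ∨ ¬ inSNopt G m u (C.b u)) ∨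
  (C.a u = C.b u ∧ C.a u ≠ none) ∨
  ¬ inSNopt G m u (C.p u)

/-- Guard of rule `Update` (matched vertices). -/
def guardUpdate (C : MMConfig V) (u : V) : Prop :=
  guardUpdateA G m C u ∨
  ((C.a u, C.b u) ≠ bestRematch G m C u ∧
    (C.p u = none ∨ ∃ w, C.p u = some w ∧ C.p w ≠ some u ∧ C.e w = true))

/-- `p_{p_u} = u`. -/
def ppEq (C : MMConfig V) (u : V) : Prop :=
  ∃ w, C.p u = some w ∧ C.p w = some u

/-- Value assigned to `s_u` by `MatchFirst` (`v = m_u`). -/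
def mfS (C : MMConfig V) (u v : V) : Prop :=
  C.p u = askFirst m C u ∧ ppEq C u ∧ (C.p v = askSecond m C v ∨ C.p v = none)

/-- Value assigned to `end_u` by `MatchFirst` (`v = m_u`). -/
def mfE (C : MMConfig V) (u v : V) : Prop :=
  C.p u = askFirst m C u ∧ ppEq C u ∧ C.s u = true ∧
  C.p v = askSecond m C v ∧ C.e v = true

/-- Guard of rule `MatchFirst` (matched vertices). -/
def guardMatchFirst (C : MMConfig V) (u : V) : Prop :=
  askFirst m C u ≠ none ∧ ∃ v, m u = some v ∧
    (C.p u ≠ askFirst m C u ∨ ¬ (C.s u = true ↔ mfS m C u v) ∨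
     ¬ (C.e u = true ↔ mfE m C u v))

/-- Value assigned to `end_u` (and then `s_u`) by `MatchSecond` (`v = m_u`). -/
def msE (C : MMConfig V) (u v : V) : Prop :=
  C.p u = askSecond m C u ∧ ppEq C u ∧ C.p v = askFirst m C v

/-- Guard of rule `MatchSecond` (matched vertices). -/
def guardMatchSecond (C : MMConfig V) (u : V) : Prop :=
  askSecond m C u ≠ none ∧ ∃ v, m u = some v ∧ C.s v = true ∧
    (C.p u ≠ askSecond m C u ∨ ¬ (C.e u = true ↔ msE m C u v) ∨ C.s u ≠ C.e u)

/-- Guard of rule `ResetMatch` (matched vertices). -/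
def guardResetMatch (C : MMConfig V) (u : V) : Prop :=
  (askFirst m C u = none ∧ askSecond m C u = none ∧
    ¬ (C.p u = none ∧ C.s u = false ∧ C.e u = false)) ∨
  (askSecond m C u ≠ none ∧ C.p u ≠ none ∧ ∃ v, m u = some v ∧ C.s v = false)

/-- The local state of `u` after it atomically executes the command of its
highest-priority true-guard rule (its state is unchanged if no guard holds). -/
noncomputable def localNext (C : MMConfig V) (u : V) : MMLocal V :=
  if m u = none then
    if guardResetEnd C u then ⟨C.p u, C.a u, C.b u, C.s u, false⟩
    else if guardUpdateP G m C u then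
      ⟨lowestSet {w | G.Adj u w ∧ C.p w = some u}, C.a u, C.b u, C.s u, false⟩
    else if guardUpdateEnd G m C u then
      ⟨C.p u, C.a u, C.b u, C.s u, (C.p u).elim (C.e u) C.e⟩
    else C.loc u
  else
    if guardUpdate G m C u then
      ⟨none, (bestRematch G m C u).1, (bestRematch G m C u).2, false, false⟩
    else if guardMatchFirst m C u then
      ⟨askFirst m C u, C.a u, C.b u,
        pb (∃ v, m u = some v ∧ mfS m C u v),
        pb (∃ v, m u = some v ∧ mfE m C u v)⟩
    else if guardMatchSecond m C u then
      ⟨askSecond m C u, C.a u, C.b u,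
        pb (∃ v, m u = some v ∧ msE m C u v),
        pb (∃ v, m u = some v ∧ msE m C u v)⟩
    else if guardResetMatch m C u then ⟨none, C.a u, C.b u, false, false⟩
    else C.loc u

/-- `u` is activable (eligible for some rule) in `C`. -/
def Activable (C : MMConfig V) (u : V) : Prop :=
  (m u = none ∧ (guardResetEnd C u ∨ guardUpdateP G m C u ∨ guardUpdateEnd G m C u)) ∨
  (m u ≠ none ∧ (guardUpdate G m C u ∨ guardMatchFirst m C u ∨
    guardMatchSecond m C u ∨ guardResetMatch m C u))

/-- A configuration is stable when no vertex is activable. -/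
def Stable (C : MMConfig V) : Prop := ∀ u, ¬ Activable G m C u

/-- One transition of the adversarial distributed daemon: the nonempty set `A`
of activable vertices simultaneously execute their (highest-priority) rules. -/
def StepOn (C C' : MMConfig V) (A : Set V) : Prop :=
  A.Nonempty ∧ (∀ u ∈ A, Activable G m C u) ∧
  (∀ u ∈ A, C'.loc u = localNext G m C u) ∧
  (∀ u, u ∉ A → C'.loc u = C.loc u)

/-- A (maximal) execution, padded with stuttering once a stable configuration is
reached: at each index either a genuine transition occurs, or the configuration
is stable and nothing moves.  `u ∈ act i` means `u` makes a move in transition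
`i ↦ i+1`. -/
structure MMExecution (G : SimpleGraph V) (m : V → Option V) where
  cfg : ℕ → MMConfig V
  act : ℕ → Set V
  valid : ∀ i, StepOn G m (cfg i) (cfg (i+1)) (act i) ∨
    (act i = ∅ ∧ Stable G m (cfg i) ∧ cfg (i+1) = cfg i)

/-- μ: the number of matched vertices. -/
noncomputable def muV : ℕ := (Finset.univ.filter fun u : V => m u ≠ none).card

/-- σ: the number of single vertices. -/
noncomputable def sigmaV : ℕ := (Finset.univ.filter fun u : V => m u = none).card

/-- The matching `M` as a relation. -/
def Mrel (a b : V) : Prop := m a = some b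

/-- The output edge set `M⁺` of a configuration, as a relation. -/
def Mplus (C : MMConfig V) (a b : V) : Prop :=
  (m a = some b ∧ C.p a = none ∧ C.p b = none) ∨
  (G.Adj a b ∧ m a ≠ some b ∧ C.p a = some b ∧ C.p b = some a)

/-- `(x,u,v,y)` is a 3-augmenting path on `(G, M')`. -/
def IsAug3 (M' : V → V → Prop) (x u v y : V) : Prop :=
  x ≠ u ∧ x ≠ v ∧ x ≠ y ∧ u ≠ v ∧ u ≠ y ∧ v ≠ y ∧
  G.Adj x u ∧ G.Adj u v ∧ G.Adj v y ∧
  M' u v ∧ ¬ M' x u ∧ ¬ M' v y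

end MaxMatchPreamble


section UpdateBound

set_option linter.unusedSectionVars false

variable {V : Type*} [Fintype V] [LinearOrder V]

/-! ### Counting lemmas -/

/-- If any two elements of `S` are separated by an element of `R`, then `S` has at most
one element more than `R`. -/
theorem card_le_card_add_one_of_separated (R : Finset ℕ) :
    ∀ S : Finset ℕ, (∀ i ∈ S, ∀ j ∈ S, i < j → ∃ k ∈ R, i ≤ k ∧ k < j) →
      S.card ≤ R.card + 1 := by
  intro S h
  rcases S.eq_empty_or_nonempty with rfl | hS
  · simp
  have key : (S.erase (S.min' hS)).card ≤ R.card := by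
    have hex : ∀ j ∈ S.erase (S.min' hS), ∃ k ∈ R, k < j ∧ ∀ i ∈ S, i < j → i ≤ k := by
      intro j hj
      obtain ⟨hne, hjS⟩ := Finset.mem_erase.1 hj
      have hlt : S.min' hS < j := lt_of_le_of_ne (S.min'_le j hjS) (Ne.symm hne)
      have hF : (S.filter (· < j)).Nonempty :=
        ⟨_, Finset.mem_filter.2 ⟨S.min'_mem hS, hlt⟩⟩
      obtain ⟨hmS, hmj⟩ := Finset.mem_filter.1 ((S.filter (· < j)).max'_mem hF)
      obtain ⟨k, hkR, hk1, hk2⟩ := h _ hmS j hjS hmj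
      exact ⟨k, hkR, hk2, fun i hi hij =>
        ((S.filter (· < j)).le_max' i (Finset.mem_filter.2 ⟨hi, hij⟩)).trans hk1⟩
    choose! f hfR hflt hfle using hex
    refine Finset.card_le_card_of_injOn f hfR ?_
    intro a ha b hb hab
    have ha' := hflt a ha
    have hb' := hflt b hb
    rcases lt_trichotomy a b with hlt | heq | hlt
    · have := hfle b hb a (Finset.mem_of_mem_erase ha) hlt
      omega
    · exact heq
    · have := hfle a ha b (Finset.mem_of_mem_erase hb) hlt
      omega
  have := Finset.card_erase_add_one (S.min'_mem hS)
  omega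

/-- The times before `N` at which a boolean sequence changes from false to true. -/
def risesBefore (f : ℕ → Bool) (N : ℕ) : Finset ℕ :=
  (Finset.range N).filter fun k => f k = false ∧ f (k + 1) = true

/-- The times before `N` at which a boolean sequence changes. -/
def changesBefore (f : ℕ → Bool) (N : ℕ) : Finset ℕ :=
  (Finset.range N).filter fun k => f k ≠ f (k + 1)

theorem card_changesBefore_le (f : ℕ → Bool) (N : ℕ) :
    (changesBefore f N).card ≤ 1 + 2 * (risesBefore f N).card := by
  have key : (changesBefore f N).card + (f N).toNat
      = 2 * (risesBefore f N).card + (f 0).toNat := by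
    induction N with
    | zero => simp [changesBefore, risesBefore]
    | succ n ih =>
      simp only [changesBefore, risesBefore, Finset.range_add_one, Finset.filter_insert] at ih ⊢
      cases h1 : f n <;> cases h2 : f (n + 1) <;> simp [h1] at ih ⊢ <;> omega
  have := Bool.toNat_le (f 0)
  omega

/-- A boolean sequence that is true at `j` and never rises on `[i, j)` is true on all of
`[i, j]`. -/
theorem true_of_no_rise {f : ℕ → Bool} {i j : ℕ} (hj : f j = true)
    (h : ∀ k, i ≤ k → k < j → ¬ (f k = false ∧ f (k + 1) = true)) :
    ∀ k, i ≤ k → k ≤ j → f k = true := by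
  intro k hik hkj
  induction hkj using Nat.decreasingInduction with
  | self => exact hj
  | of_succ k hk ih =>
    have h1 := ih (by omega)
    have h2 := h k hik hk
    cases hf : f k
    · exact absurd ⟨hf, h1⟩ h2
    · rfl

/-! ### Local facts about the rules -/

theorem lowestSet_eq_some {S : Set V} {x : V} (h : lowestSet S = some x) :
    x ∈ S ∧ ∀ y ∈ S, x ≤ y := by
  unfold lowestSet at h
  split_ifs at h with hne
  have hx := Option.some.inj h
  subst hx
  exact ⟨(Finset.mem_filter.1 (Finset.min'_mem _ hne)).2,
    fun y hy => Finset.min'_le _ _ (Finset.mem_filter.2 ⟨Finset.mem_univ _, hy⟩)⟩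

theorem lowestOpt_eq_some {S : Finset (Option V)} {x : V} (h : lowestOpt S = some x) :
    some x ∈ S :=
  (lowestSet_eq_some h).1

theorem pb_eq_true {P : Prop} : pb P = true ↔ P := by
  unfold pb
  split_ifs with h <;> simp [h]

variable {G : SimpleGraph V} {m : V → Option V}

theorem askFirst_eq_none_or (C : MMConfig V) (u : V) :
    askFirst m C u = none ∨ askFirst m C u = C.a u := by
  unfold askFirst
  split
  · exact Or.inl rfl
  · split_ifs <;> simp

theorem askSecond_eq_none_or (C : MMConfig V) (u : V) :
    askSecond m C u = none ∨ askSecond m C u = C.a u ∨ askSecond m C u = C.b u := by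
  unfold askSecond
  split
  · exact Or.inl rfl
  · split_ifs
    · rcases h : lowestOpt _ with _ | x
      · exact Or.inl rfl
      · have := lowestOpt_eq_some h
        simp only [Finset.mem_sdiff, Finset.mem_insert, Finset.mem_singleton] at this
        exact Or.inr this.1
    · exact Or.inl rfl

theorem askSecond_eq_none_of_askFirst (hm : MaxMatchingOn G m) {C : MMConfig V} {u v : V}
    (huv : m u = some v) (h : askFirst m C u ≠ none) : askSecond m C u = none := by
  have hvu := hm.symm u v huv
  by_contra hne
  have h2 : askFirst m C v ≠ none := by
    intro h0
    simp [askSecond, huv, h0] at hne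
  obtain ⟨x, hx⟩ := Option.ne_none_iff_exists'.1 hne
  simp only [askSecond, huv, h2, ne_eq, not_false_eq_true, if_true] at hx
  have hx' := lowestOpt_eq_some hx
  simp only [Finset.mem_sdiff, Finset.mem_insert, Finset.mem_singleton] at hx'
  simp only [askFirst, huv] at h
  simp only [askFirst, hvu] at h2
  split_ifs at h with c1
  · split_ifs at h2 with c2
    · obtain ⟨-, -, -, d1⟩ := c1
      obtain ⟨-, -, -, d2⟩ := c2
      have hlt : ∀ o o' : Option V, optLT o o' → ¬ optLT o' o ∧ o ≠ o' := by
        intro o o' ho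
        cases o <;> cases o' <;> simp [optLT] at ho ⊢
        exact ⟨ho.le, ho.ne⟩
      rcases d1 with d1 | ⟨e1, b1⟩ | ⟨e1, b1, l1⟩
      · have := hlt _ _ d1
        rcases d2 with d2 | ⟨e2, -⟩ | ⟨e2, -⟩
        · exact this.1 d2
        · exact this.2 e2.symm
        · exact this.2 e2.symm
      · rcases hx' with ⟨hx1 | hx1, hx2⟩
        · exact hx2 (hx1.trans e1)
        · simp [b1] at hx1
      · rcases d2 with d2 | ⟨e2, b2⟩ | ⟨e2, b2, l2⟩
        · exact (hlt _ _ d2).2 e1.symm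
        · exact b1 b2
        · exact lt_asymm l1 l2
    · exact h2 rfl
  · exact h rfl

theorem askFirst_congr {C C' : MMConfig V} {u v : V} (huv : m u = some v)
    (hau : C'.a u = C.a u) (hbu : C'.b u = C.b u) (hav : C'.a v = C.a v)
    (hbv : C'.b v = C.b v) : askFirst m C' u = askFirst m C u := by
  simp only [askFirst, huv, hau, hbu, hav, hbv]

theorem askSecond_congr (hm : MaxMatchingOn G m) {C C' : MMConfig V} {u v : V}
    (huv : m u = some v)
    (hau : C'.a u = C.a u) (hbu : C'.b u = C.b u) (hav : C'.a v = C.a v)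
    (hbv : C'.b v = C.b v) : askSecond m C' u = askSecond m C u := by
  simp only [askSecond, huv, hau, hbu, hav,
    askFirst_congr (hm.symm u v huv) hav hbv hau hbu]

/-- The vertices of `A` execute their rules between `C` and `C'`, the others do not move. -/
structure MovesOn (G : SimpleGraph V) (m : V → Option V) (C C' : MMConfig V) (A : Set V) :
    Prop where
  activable : ∀ u ∈ A, Activable G m C u
  next : ∀ u ∈ A, C'.loc u = localNext G m C u
  same : ∀ u, u ∉ A → C'.loc u = C.loc u

theorem MMExecution.movesOn (E : MMExecution G m) (i : ℕ) :
    MovesOn G m (E.cfg i) (E.cfg (i + 1)) (E.act i) := by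
  rcases E.valid i with h | ⟨h1, -, h3⟩
  · exact ⟨h.2.1, h.2.2.1, h.2.2.2⟩
  · exact ⟨by simp [h1], by simp [h1], by simp [h3]⟩

/-- A mutual pointer from a single vertex is kept, and `end` is either kept or copied. -/
theorem MovesOn.single_mutual {C C' : MMConfig V} {A : Set V} (h : MovesOn G m C C' A)
    {x w : V} (hx : m x = none) (hxw : G.Adj x w) (hw : m w ≠ none)
    (hp : C.p x = some w) (hpw : C.p w = some x) :
    C'.p x = some w ∧ (C'.e x = C.e x ∨ C'.e x = C.e w) := by
  by_cases hA : x ∈ A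
  · have hl := h.next x hA
    have g1 : ¬ guardResetEnd C x := by simp [guardResetEnd, hp]
    have g2 : ¬ guardUpdateP G m C x := by simp [guardUpdateP, hp, hpw, hxw, hw]
    simp only [localNext, hx, g1, g2, if_true, if_false] at hl
    split_ifs at hl <;> simp only [MMConfig.loc, MMLocal.mk.injEq, hp, Option.elim] at hl
    · exact ⟨hl.1, Or.inr hl.2.2.2.2⟩
    · exact ⟨hl.1, Or.inl hl.2.2.2.2⟩
  · have hl := h.same x hA
    simp only [MMConfig.loc, MMLocal.mk.injEq] at hl
    exact ⟨hl.1.trans hp, Or.inl hl.2.2.2.2⟩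

/-- A single vertex whose `end` is true after a transition has kept its pointer. -/
theorem MovesOn.single_p_eq {C C' : MMConfig V} {A : Set V} (h : MovesOn G m C C' A)
    {x : V} (hx : m x = none) (he : C'.e x = true) : C'.p x = C.p x := by
  by_cases hA : x ∈ A
  · have hl := h.next x hA
    simp only [localNext, hx, if_true] at hl
    split_ifs at hl <;> simp only [MMConfig.loc, MMLocal.mk.injEq] at hl
    · exact hl.1
    · simp [he] at hl
    · exact hl.1
    · exact hl.1
  · have hl := h.same x hA
    simp only [MMConfig.loc, MMLocal.mk.injEq] at hl
    exact hl.1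

/-- A single vertex sets `end` to true only when copying it from a mutual pointer. -/
theorem MovesOn.single_rise {C C' : MMConfig V} {A : Set V} (h : MovesOn G m C C' A)
    {x : V} (hx : m x = none) (he : C.e x = false) (he' : C'.e x = true) :
    ∃ w, C.p x = some w ∧ G.Adj x w ∧ m w ≠ none ∧ C.p w = some x ∧ C.e w = true := by
  by_cases hA : x ∈ A
  · have hl := h.next x hA
    simp only [localNext, hx, if_true] at hl
    split_ifs at hl with g1 g2 g3 <;> simp only [MMConfig.loc, MMLocal.mk.injEq] at hl
    · simp [he'] at hl
    · simp [he'] at hl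
    · obtain ⟨w, h1, h2, h3, h4, h5⟩ := g3
      refine ⟨w, h1, h2, h3, h4, ?_⟩
      cases hw : C.e w
      · simp [he, hw] at h5
      · rfl
    · simp [he, he'] at hl
  · have hl := h.same x hA
    simp [MMConfig.loc, he, he'] at hl

/-- What a matched vertex `u` with partner `v` may do in one transition. -/
theorem MovesOn.matched_cases {C C' : MMConfig V} {A : Set V} (h : MovesOn G m C C' A)
    {u v : V} (huv : m u = some v) (hA : u ∈ A) :
    (guardUpdate G m C u ∧ C'.p u = none ∧ (C'.a u, C'.b u) = bestRematch G m C u ∧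
      C'.s u = false ∧ C'.e u = false) ∨
    (¬ guardUpdate G m C u ∧ C'.a u = C.a u ∧ C'.b u = C.b u ∧
      ((guardMatchFirst m C u ∧ C'.p u = askFirst m C u ∧
          (C'.s u = true ↔ mfS m C u v) ∧ (C'.e u = true ↔ mfE m C u v)) ∨
        (guardMatchSecond m C u ∧ C'.p u = askSecond m C u ∧
          (C'.s u = true ↔ msE m C u v) ∧ (C'.e u = true ↔ msE m C u v)) ∨
        (guardResetMatch m C u ∧ C'.p u = none ∧ C'.s u = false ∧ C'.e u = false))) := by
  have hl := h.next u hA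
  simp only [localNext, huv, reduceCtorEq, if_false] at hl
  split_ifs at hl with g1 g2 g3 g4 <;>
    simp only [MMConfig.loc, MMLocal.mk.injEq] at hl <;>
    obtain ⟨l1, l2, l3, l4, l5⟩ := hl
  · exact Or.inl ⟨g1, l1, by rw [l2, l3], l4, l5⟩
  · refine Or.inr ⟨g1, l2, l3, Or.inl ⟨g2, l1, ?_, ?_⟩⟩
    · rw [l4, pb_eq_true]; simp
    · rw [l5, pb_eq_true]; simp
  · refine Or.inr ⟨g1, l2, l3, Or.inr (Or.inl ⟨g3, l1, ?_, ?_⟩)⟩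
    · rw [l4, pb_eq_true]; simp
    · rw [l5, pb_eq_true]; simp
  · exact Or.inr ⟨g1, l2, l3, Or.inr (Or.inr ⟨g4, l1, l4, l5⟩)⟩
  · have hact := h.activable u hA
    simp [Activable, huv, g1, g2, g3, g4] at hact

/-- A matched vertex whose `end` is true after a transition has kept its pointer. -/
theorem MovesOn.matched_p_eq {C C' : MMConfig V} {A : Set V} (h : MovesOn G m C C' A)
    {u : V} (hu : m u ≠ none) (he : C'.e u = true) : C'.p u = C.p u := by
  obtain ⟨v, huv⟩ := Option.ne_none_iff_exists'.1 hu
  by_cases hA : u ∈ A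
  · rcases h.matched_cases huv hA with ⟨-, -, -, -, h5⟩ | ⟨-, -, -, h4⟩
    · simp [he] at h5
    · rcases h4 with ⟨-, h1, -, h3⟩ | ⟨-, h1, -, h3⟩ | ⟨-, -, -, h3⟩
      · exact h1.trans (h3.1 he).1.symm
      · exact h1.trans (h3.1 he).1.symm
      · simp [he] at h3
  · exact congrArg MMLocal.p (h.same u hA)

/-- The pair computed by `BestRematch` consists of increasing single neighbors. -/
theorem bestRematch_spec (C : MMConfig V) (u : V) {a b : Option V}
    (h : (a, b) = bestRematch G m C u) :
    ¬ optLT b a ∧ inSNopt G m u a ∧ inSNopt G m u b ∧ ¬ (a = b ∧ a ≠ none) := by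
  simp only [bestRematch, Prod.mk.injEq] at h
  obtain ⟨ha, hb⟩ := h
  cases a with
  | none =>
    rw [← ha] at hb
    simp only [Option.elim] at hb
    subst hb
    simp [optLT, inSNopt]
  | some x =>
    have h1 := lowestSet_eq_some ha.symm
    rw [← ha] at hb
    simp only [Option.elim] at hb
    have hx : inSNopt G m u (some x) := Or.inr ⟨x, rfl, h1.1.1, h1.1.2.1⟩
    cases b with
    | none => simp [optLT, inSNopt] at hx ⊢; exact hx
    | some y =>
      have h2 := lowestSet_eq_some hb.symm
      have hxy := h1.2 y h2.1.1
      refine ⟨by simpa [optLT] using hxy, hx, Or.inr ⟨y, rfl, h2.1.1.1, h2.1.1.2.1⟩, ?_⟩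
      rintro ⟨h3, -⟩
      exact h2.1.2 (Option.some.inj h3).symm

/-- The first part of the guard of `Update` is false after any move. -/
theorem MovesOn.not_guardUpdateA {C C' : MMConfig V} {A : Set V} (h : MovesOn G m C C' A)
    {u : V} (hu : m u ≠ none) (hA : u ∈ A ∨ ¬ guardUpdateA G m C u) :
    ¬ guardUpdateA G m C' u := by
  obtain ⟨v, huv⟩ := Option.ne_none_iff_exists'.1 hu
  by_cases hA' : u ∈ A
  · rcases h.matched_cases huv hA' with ⟨-, h2, h3, -⟩ | ⟨h1, h2, h3, h4⟩
    · obtain ⟨s1, s2, s3, s4⟩ := bestRematch_spec C u h3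
      rintro (g | (g | g) | g | g)
      · exact s1 g
      · exact g s2
      · exact g s3
      · exact s4 g
      · exact g (Or.inl h2)
    · have nA : ¬ guardUpdateA G m C u := fun g => h1 (Or.inl g)
      have hin : inSNopt G m u (C.a u) ∧ inSNopt G m u (C.b u) := by
        refine ⟨?_, ?_⟩ <;> by_contra g <;> apply nA
        · exact Or.inr (Or.inl (Or.inl g))
        · exact Or.inr (Or.inl (Or.inr g))
      have hp : inSNopt G m u (C'.p u) := by
        rcases h4 with ⟨-, h5, -⟩ | ⟨-, h5, -⟩ | ⟨-, h5, -⟩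
        · rcases askFirst_eq_none_or (m := m) C u with h6 | h6 <;> rw [h5, h6]
          · exact Or.inl rfl
          · exact hin.1
        · rcases askSecond_eq_none_or (m := m) C u with h6 | h6 | h6 <;> rw [h5, h6]
          · exact Or.inl rfl
          · exact hin.1
          · exact hin.2
        · exact Or.inl h5
      rintro (g | g | g | g)
      · exact nA (Or.inl (by rwa [h2, h3] at g))
      · exact nA (Or.inr (Or.inl (by rwa [h2, h3] at g)))
      · exact nA (Or.inr (Or.inr (Or.inl (by rwa [h2, h3] at g))))
      · exact g hp
  · have hl := h.same u hA'
    simp only [MMConfig.loc, MMLocal.mk.injEq] at hl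
    obtain ⟨l1, l2, l3, -⟩ := hl
    have nA := hA.resolve_left hA'
    simpa only [guardUpdateA, l1, l2, l3] using nA

/-- A mutual pointer of a matched vertex persists while the vertex keeps its pointer. -/
theorem MovesOn.ppEq {C C' : MMConfig V} {A : Set V} (h : MovesOn G m C C' A)
    {u : V} (hu : m u ≠ none) (nA : ¬ guardUpdateA G m C u) (hpp : ppEq C u)
    (hp : C'.p u = C.p u) : ppEq C' u := by
  obtain ⟨w, h1, h2⟩ := hpp
  have hin : inSNopt G m u (C.p u) := by
    by_contra g
    exact nA (Or.inr (Or.inr (Or.inr g)))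
  rcases hin with h3 | ⟨w', h3, h4, h5⟩
  · simp [h1] at h3
  · obtain rfl : w = w' := Option.some.inj (h1.symm.trans h3)
    exact ⟨w, hp.trans h1, (h.single_mutual h5 h4.symm hu h2 h1).1⟩

theorem not_guardUpdate_of_ppEq {C : MMConfig V} {u : V} (nA : ¬ guardUpdateA G m C u)
    (hpp : ppEq C u) : ¬ guardUpdate G m C u := by
  obtain ⟨w, h1, h2⟩ := hpp
  rintro (g | ⟨-, g | ⟨w', g1, g2, -⟩⟩)
  · exact nA g
  · simp [h1] at g
  · obtain rfl : w = w' := Option.some.inj (h1.symm.trans g1)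
    exact g2 h2

theorem ppEq.p_ne_none {C : MMConfig V} {u : V} (h : ppEq C u) : C.p u ≠ none := by
  obtain ⟨w, h1, -⟩ := h
  simp [h1]

/-! ### Rematched pairs of matched vertices -/

/-- Consistency of the booleans of a matched vertex with its pointer; it holds once the
vertex has moved. -/
structure Coherent (G : SimpleGraph V) (m : V → Option V) (C : MMConfig V) (u : V) :
    Prop where
  notA : ¬ guardUpdateA G m C u
  mutual_of_s : C.s u = true → ppEq C u
  s_of_e : C.e u = true → C.s u = true

theorem MovesOn.coherent {C C' : MMConfig V} {A : Set V} (h : MovesOn G m C C' A)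
    {u : V} (hu : m u ≠ none) (hA : u ∈ A ∨ Coherent G m C u) : Coherent G m C' u := by
  suffices hb : (C'.s u = true → _root_.ppEq C' u) ∧ (C'.e u = true → C'.s u = true) from
    ⟨h.not_guardUpdateA hu (hA.imp_right Coherent.notA), hb.1, hb.2⟩
  obtain ⟨v, huv⟩ := Option.ne_none_iff_exists'.1 hu
  by_cases hA' : u ∈ A
  · rcases h.matched_cases huv hA' with ⟨-, -, -, h4, h5⟩ | ⟨h1, h2, h3, h4⟩
    · simp [h4, h5]
    · have nA : ¬ guardUpdateA G m C u := fun g => h1 (Or.inl g)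
      rcases h4 with ⟨-, h5, h6, h7⟩ | ⟨-, h5, h6, h7⟩ | ⟨-, -, h6, h7⟩
      · refine ⟨fun hs => ?_, fun he => ?_⟩
        · have := h6.1 hs
          exact h.ppEq hu nA this.2.1 (h5.trans this.1.symm)
        · have := h7.1 he
          exact h6.2 ⟨this.1, this.2.1, Or.inl this.2.2.2.1⟩
      · refine ⟨fun hs => ?_, fun he => h6.2 (h7.1 he)⟩
        have := h6.1 hs
        exact h.ppEq hu nA this.2.1 (h5.trans this.1.symm)
      · simp [h6, h7]
  · have hc := hA.resolve_left hA'
    have hl := h.same u hA'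
    simp only [MMConfig.loc, MMLocal.mk.injEq] at hl
    obtain ⟨l1, -, -, l4, l5⟩ := hl
    exact ⟨fun hs => h.ppEq hu hc.notA (hc.mutual_of_s (l4 ▸ hs)) l1,
      fun he => by rw [l4]; exact hc.s_of_e (l5 ▸ he)⟩

/-- `u` is a First vertex, rematched with its candidate, that has seen its partner `v`
terminate. -/
structure FirstDone (G : SimpleGraph V) (m : V → Option V) (C : MMConfig V) (u v : V) :
    Prop where
  notA : ¬ guardUpdateA G m C u
  pp : ppEq C u
  p_eq : C.p u = askFirst m C u
  s_eq : C.s u = true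
  e_eq : C.e u = true
  partner_p : C.p v = askSecond m C v
  partner_e : C.e v = true

/-- `v` is a Second vertex, rematched with its candidate, that has terminated while its
partner `u` points to its own candidate. -/
structure SecondDone (G : SimpleGraph V) (m : V → Option V) (C : MMConfig V) (v u : V) :
    Prop where
  notA : ¬ guardUpdateA G m C v
  pp : ppEq C v
  p_eq : C.p v = askSecond m C v
  s_eq : C.s v = true
  e_eq : C.e v = true
  partner_p : C.p u = askFirst m C u
  partner_s : C.s u = true

theorem FirstDone.loc_eq (hm : MaxMatchingOn G m) {C C' : MMConfig V} {A : Set V}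
    (h : MovesOn G m C C' A) {u v : V} (huv : m u = some v) (hd : FirstDone G m C u v) :
    C'.loc u = C.loc u := by
  refine h.same u fun hA => ?_
  have h0 : askFirst m C u ≠ none := hd.p_eq ▸ hd.pp.p_ne_none
  have h1 := askSecond_eq_none_of_askFirst hm huv h0
  have hS : mfS m C u v := ⟨hd.p_eq, hd.pp, Or.inl hd.partner_p⟩
  have hE : mfE m C u v := ⟨hd.p_eq, hd.pp, hd.s_eq, hd.partner_p, hd.partner_e⟩
  rcases h.activable u hA with ⟨g, -⟩ | ⟨-, g | ⟨-, w, g1, g⟩ | ⟨g, -⟩ | ⟨g, -⟩ | ⟨g, -⟩⟩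
  · simp [huv] at g
  · exact not_guardUpdate_of_ppEq hd.notA hd.pp g
  · obtain rfl : v = w := Option.some.inj (huv.symm.trans g1)
    simp [hd.p_eq.symm, hS, hE, hd.s_eq, hd.e_eq] at g
  · exact g h1
  · exact h0 g
  · exact g h1

theorem SecondDone.loc_eq (hm : MaxMatchingOn G m) {C C' : MMConfig V} {A : Set V}
    (h : MovesOn G m C C' A) {u v : V} (hvu : m v = some u) (hd : SecondDone G m C v u) :
    C'.loc v = C.loc v := by
  refine h.same v fun hA => ?_
  have h0 : askSecond m C v ≠ none := hd.p_eq ▸ hd.pp.p_ne_none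
  have hE : msE m C v u := ⟨hd.p_eq, hd.pp, hd.partner_p⟩
  rcases h.activable v hA with ⟨g, -⟩ | ⟨-, g | ⟨g, -⟩ | ⟨-, w, g1, -, g⟩ | ⟨-, g, -⟩ |
    ⟨-, -, w, g1, g⟩⟩
  · simp [hvu] at g
  · exact not_guardUpdate_of_ppEq hd.notA hd.pp g
  · exact h0 (askSecond_eq_none_of_askFirst hm hvu g)
  · obtain rfl : u = w := Option.some.inj (hvu.symm.trans g1)
    simp [hd.p_eq.symm, hE, hd.s_eq, hd.e_eq] at g
  · exact h0 g
  · obtain rfl : u = w := Option.some.inj (hvu.symm.trans g1)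
    simp [hd.partner_s] at g

theorem FirstDone.step (hm : MaxMatchingOn G m) {C C' : MMConfig V} {A : Set V}
    (h : MovesOn G m C C' A) {u v : V} (huv : m u = some v) (hd : FirstDone G m C u v)
    (hv : C'.loc v = C.loc v) : FirstDone G m C' u v := by
  have hu := hd.loc_eq hm h huv
  have hne : m u ≠ none := by simp [huv]
  have nA := h.not_guardUpdateA hne (Or.inr hd.notA)
  simp only [MMConfig.loc, MMLocal.mk.injEq] at hu hv
  obtain ⟨u1, u2, u3, u4, u5⟩ := hu
  obtain ⟨v1, v2, v3, v4, v5⟩ := hv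
  refine ⟨nA, h.ppEq hne hd.notA hd.pp u1, ?_, u4.trans hd.s_eq, u5.trans hd.e_eq, ?_,
    v5.trans hd.partner_e⟩
  · rw [u1, hd.p_eq, askFirst_congr huv u2 u3 v2 v3]
  · rw [v1, hd.partner_p, askSecond_congr hm (hm.symm u v huv) v2 v3 u2 u3]

theorem SecondDone.step (hm : MaxMatchingOn G m) {C C' : MMConfig V} {A : Set V}
    (h : MovesOn G m C C' A) {u v : V} (hvu : m v = some u) (hd : SecondDone G m C v u)
    (hp : C'.p u = C.p u) (ha : C'.a u = C.a u) (hb : C'.b u = C.b u)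
    (hs : C'.s u = C.s u) : SecondDone G m C' v u := by
  have hv := hd.loc_eq hm h hvu
  have hne : m v ≠ none := by simp [hvu]
  have nA := h.not_guardUpdateA hne (Or.inr hd.notA)
  simp only [MMConfig.loc, MMLocal.mk.injEq] at hv
  obtain ⟨v1, v2, v3, v4, v5⟩ := hv
  refine ⟨nA, h.ppEq hne hd.notA hd.pp v1, ?_, v4.trans hd.s_eq, v5.trans hd.e_eq, ?_,
    hs.trans hd.partner_s⟩
  · rw [v1, hd.p_eq, askSecond_congr hm hvu v2 v3 ha hb]
  · rw [hp, hd.partner_p, askFirst_congr (hm.symm v u hvu) ha hb v2 v3]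

/-- While the Second vertex `v` points to its candidate, a First vertex `u` that is rematched
and has set `s` keeps everything but possibly `end`. -/
theorem MovesOn.first_keeps (hm : MaxMatchingOn G m) {C C' : MMConfig V} {A : Set V}
    (h : MovesOn G m C C' A) {u v : V} (huv : m u = some v) (nA : ¬ guardUpdateA G m C u)
    (hpp : _root_.ppEq C u) (hp : C.p u = askFirst m C u) (hs : C.s u = true)
    (hpv : C.p v = askSecond m C v) :
    C'.p u = C.p u ∧ C'.a u = C.a u ∧ C'.b u = C.b u ∧ C'.s u = C.s u := by
  have h0 : askFirst m C u ≠ none := hp ▸ hpp.p_ne_none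
  have h1 := askSecond_eq_none_of_askFirst hm huv h0
  by_cases hA : u ∈ A
  · rcases h.matched_cases huv hA with ⟨g, -⟩ | ⟨-, h2, h3, h4⟩
    · exact absurd g (not_guardUpdate_of_ppEq nA hpp)
    · rcases h4 with ⟨-, h5, h6, -⟩ | ⟨⟨g, -⟩, -⟩ | ⟨⟨g, -⟩ | ⟨g, -⟩, -⟩
      · exact ⟨h5.trans hp.symm, h2, h3, (h6.2 ⟨hp, hpp, Or.inl hpv⟩).trans hs.symm⟩
      · exact absurd h1 g
      · exact absurd g h0
      · exact absurd h1 g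
  · have hl := h.same u hA
    simp only [MMConfig.loc, MMLocal.mk.injEq] at hl
    exact ⟨hl.1, hl.2.1, hl.2.2.1, hl.2.2.2.1⟩

/-- The ways in which a matched vertex sets `end` to true. -/
theorem MovesOn.matched_rise {C C' : MMConfig V} {A : Set V} (h : MovesOn G m C C' A)
    {u v : V} (huv : m u = some v) (he : C.e u = false) (he' : C'.e u = true) :
    ¬ guardUpdateA G m C u ∧ C'.p u = C.p u ∧ C'.a u = C.a u ∧ C'.b u = C.b u ∧
      C'.s u = true ∧ (mfE m C u v ∨ (msE m C u v ∧ C.s v = true)) := by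
  have hA : u ∈ A := by
    by_contra hA
    have hl := congrArg MMLocal.e (h.same u hA)
    simp [MMConfig.loc, he, he'] at hl
  rcases h.matched_cases huv hA with ⟨-, -, -, -, h5⟩ | ⟨h1, h2, h3, h4⟩
  · simp [he'] at h5
  · refine ⟨fun g => h1 (Or.inl g), ?_⟩
    rcases h4 with ⟨-, h5, h6, h7⟩ | ⟨⟨-, w, g1, g2, -⟩, h5, h6, h7⟩ | ⟨-, -, -, h7⟩
    · have hE := h7.1 he'
      exact ⟨h5.trans hE.1.symm, h2, h3, h6.2 ⟨hE.1, hE.2.1, Or.inl hE.2.2.2.1⟩, Or.inl hE⟩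
    · obtain rfl : v = w := Option.some.inj (huv.symm.trans g1)
      have hE := h7.1 he'
      exact ⟨h5.trans hE.1.symm, h2, h3, h6.2 hE, Or.inr ⟨hE, g2⟩⟩
    · simp [he'] at h7

theorem MovesOn.firstDone_of_rise (hm : MaxMatchingOn G m) {C C' : MMConfig V} {A : Set V}
    (h : MovesOn G m C C' A) {u v : V} (huv : m u = some v) (he : C.e u = false)
    (he' : C'.e u = true) (hE : mfE m C u v) (hv : C'.loc v = C.loc v) :
    FirstDone G m C' u v := by
  obtain ⟨nA, u1, u2, u3, u4, -⟩ := h.matched_rise huv he he'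
  have hne : m u ≠ none := by simp [huv]
  simp only [MMConfig.loc, MMLocal.mk.injEq] at hv
  obtain ⟨v1, v2, v3, v4, v5⟩ := hv
  refine ⟨h.not_guardUpdateA hne (Or.inr nA), h.ppEq hne nA hE.2.1 u1, ?_, u4, he', ?_,
    v5.trans hE.2.2.2.2⟩
  · rw [u1, hE.1, askFirst_congr huv u2 u3 v2 v3]
  · rw [v1, hE.2.2.2.1, askSecond_congr hm (hm.symm u v huv) v2 v3 u2 u3]

theorem MovesOn.secondDone_of_rise (hm : MaxMatchingOn G m) {C C' : MMConfig V} {A : Set V}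
    (h : MovesOn G m C C' A) {u v : V} (huv : m u = some v) (he : C.e u = false)
    (he' : C'.e u = true) (hE : msE m C u v) (hs : C.s v = true)
    (hv : C'.p v = C.p v ∧ C'.a v = C.a v ∧ C'.b v = C.b v ∧ C'.s v = C.s v) :
    SecondDone G m C' u v := by
  obtain ⟨nA, u1, u2, u3, u4, -⟩ := h.matched_rise huv he he'
  have hne : m u ≠ none := by simp [huv]
  obtain ⟨v1, v2, v3, v4⟩ := hv
  refine ⟨h.not_guardUpdateA hne (Or.inr nA), h.ppEq hne nA hE.2.1 u1, ?_, u4, he', ?_,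
    v4.trans hs⟩
  · rw [u1, hE.1, askSecond_congr hm huv u2 u3 v2 v3]
  · rw [v1, hE.2.2, askFirst_congr (hm.symm u v huv) v2 v3 u2 u3]

/-! ### Executions -/

theorem MMExecution.coherent (E : MMExecution G m) {u : V} (hu : m u ≠ none) {i j : ℕ}
    (hij : i < j) (hact : u ∈ E.act i) : Coherent G m (E.cfg j) u := by
  induction j, hij using Nat.le_induction with
  | base => exact (E.movesOn i).coherent hu (Or.inl hact)
  | succ k _ ih => exact (E.movesOn k).coherent hu (Or.inr ih)

/-- A matched vertex sets `end` to true a second time only after its partner has moved. -/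
theorem MMExecution.partner_moves_of_rises (hm : MaxMatchingOn G m) (E : MMExecution G m)
    {u v : V} (huv : m u = some v) {i j : ℕ} (hij : i < j)
    (hi : (E.cfg i).e u = false) (hi' : (E.cfg (i + 1)).e u = true)
    (hj : (E.cfg j).e u = false) : ∃ k, k < j ∧ v ∈ E.act k := by
  by_contra! hno
  have hloc : ∀ k, k < j → (E.cfg (k + 1)).loc v = (E.cfg k).loc v := fun k hk =>
    (E.movesOn k).same v (hno k hk)
  suffices h : ∀ k, i + 1 ≤ k → k ≤ j →
      FirstDone G m (E.cfg k) u v ∨ SecondDone G m (E.cfg k) u v by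
    rcases h j hij le_rfl with h | h
    · simp [h.e_eq] at hj
    · simp [h.e_eq] at hj
  intro k hik
  have hM := E.movesOn i
  have hv := hloc i hij
  induction k, hik using Nat.le_induction with
  | base =>
    intro _
    rcases (hM.matched_rise huv hi hi').2.2.2.2.2 with hE | ⟨hE, hs⟩
    · exact Or.inl (hM.firstDone_of_rise hm huv hi hi' hE hv)
    · simp only [MMConfig.loc, MMLocal.mk.injEq] at hv
      exact Or.inr (hM.secondDone_of_rise hm huv hi hi' hE hs
        ⟨hv.1, hv.2.1, hv.2.2.1, hv.2.2.2.1⟩)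
  | succ k _ ih =>
    intro hk
    have hvk := hloc k (by omega)
    rcases ih (by omega) with h | h
    · exact Or.inl (h.step hm (E.movesOn k) huv hvk)
    · simp only [MMConfig.loc, MMLocal.mk.injEq] at hvk
      exact Or.inr (h.step hm (E.movesOn k) huv hvk.1 hvk.2.1 hvk.2.2.1 hvk.2.2.2.1)

/-- A matched vertex that sets `end` to true after its partner has moved keeps it true. -/
theorem MMExecution.e_true_of_rise (hm : MaxMatchingOn G m) (E : MMExecution G m)
    {u v : V} (huv : m u = some v) {i j k : ℕ} (hij : i < j) (hact : v ∈ E.act i)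
    (hj : (E.cfg j).e u = false) (hj' : (E.cfg (j + 1)).e u = true) (hjk : j < k) :
    (E.cfg k).e u = true := by
  have hvu := hm.symm u v huv
  have hv : m v ≠ none := by simp [hvu]
  have hc := E.coherent hv hij hact
  have hM := E.movesOn j
  suffices h : (FirstDone G m (E.cfg k) u v ∧ SecondDone G m (E.cfg k) v u) ∨
      (SecondDone G m (E.cfg k) u v ∧ ¬ guardUpdateA G m (E.cfg k) v ∧
        ppEq (E.cfg k) v) by
    rcases h with h | h
    · exact h.1.e_eq
    · exact h.1.e_eq
  induction k, hjk using Nat.le_induction with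
  | base =>
    obtain ⟨nA, u1, u2, u3, u4, hE⟩ := hM.matched_rise huv hj hj'
    rcases hE with hE | ⟨hE, hs⟩
    · left
      have hsv := hc.s_of_e hE.2.2.2.2
      have hd : SecondDone G m (E.cfg j) v u :=
        ⟨hc.notA, hc.mutual_of_s hsv, hE.2.2.2.1, hsv, hE.2.2.2.2, hE.1, hE.2.2.1⟩
      exact ⟨hM.firstDone_of_rise hm huv hj hj' hE (hd.loc_eq hm hM hvu),
        hd.step hm hM hvu u1 u2 u3 (u4.trans hE.2.2.1.symm)⟩
    · right
      have hpp := hc.mutual_of_s hs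
      have hk := hM.first_keeps hm hvu hc.notA hpp hE.2.2 hs hE.1
      exact ⟨hM.secondDone_of_rise hm huv hj hj' hE hs hk,
        hM.not_guardUpdateA hv (Or.inr hc.notA), hM.ppEq hv hc.notA hpp hk.1⟩
  | succ k _ ih =>
    have hM := E.movesOn k
    rcases ih with ⟨h1, h2⟩ | ⟨h1, nA, hpp⟩
    · left
      refine ⟨h1.step hm hM huv (h2.loc_eq hm hM hvu), ?_⟩
      have hl := h1.loc_eq hm hM huv
      simp only [MMConfig.loc, MMLocal.mk.injEq] at hl
      exact h2.step hm hM hvu hl.1 hl.2.1 hl.2.2.1 hl.2.2.2.1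
    · right
      obtain ⟨k1, k2, k3, k4⟩ := hM.first_keeps hm hvu nA hpp h1.partner_p h1.partner_s h1.p_eq
      exact ⟨h1.step hm hM huv k1 k2 k3 k4, hM.not_guardUpdateA hv (Or.inr nA),
        hM.ppEq hv nA hpp k1⟩

/-- A matched vertex sets `end` from false to true at most twice. -/
theorem MMExecution.card_rises_matched_le (hm : MaxMatchingOn G m) (E : MMExecution G m)
    {u : V} (hu : m u ≠ none) (N : ℕ) :
    (risesBefore (fun k => (E.cfg k).e u) N).card ≤ 2 := by
  obtain ⟨v, huv⟩ := Option.ne_none_iff_exists'.1 hu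
  set S := risesBefore (fun k => (E.cfg k).e u) N with hS
  have hmem : ∀ i ∈ S, (E.cfg i).e u = false ∧ (E.cfg (i + 1)).e u = true := fun i hi =>
    (Finset.mem_filter.1 hi).2
  have hthree : ∀ i ∈ S, ∀ j ∈ S, ∀ k ∈ S, i < j → ¬ j < k := by
    intro i hi j hj k hk hij hjk
    obtain ⟨l, hl, hact⟩ := E.partner_moves_of_rises hm huv hij (hmem i hi).1 (hmem i hi).2
      (hmem j hj).1
    have := E.e_true_of_rise hm huv hl hact (hmem j hj).1 (hmem j hj).2 hjk
    simp [(hmem k hk).1] at this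
  rcases S.eq_empty_or_nonempty with h0 | hne
  · simp [h0]
  have hlt : ∀ j ∈ S.erase (S.min' hne), S.min' hne < j := fun j hj =>
    lt_of_le_of_ne (S.min'_le j (Finset.mem_of_mem_erase hj)) (Finset.ne_of_mem_erase hj).symm
  have h1 : (S.erase (S.min' hne)).card ≤ 1 := by
    refine Finset.card_le_one.2 fun a ha b hb => ?_
    have ha' := Finset.mem_of_mem_erase ha
    have hb' := Finset.mem_of_mem_erase hb
    exact le_antisymm
      (not_lt.1 (hthree _ (S.min'_mem hne) b hb' a ha' (hlt b hb)))
      (not_lt.1 (hthree _ (S.min'_mem hne) a ha' b hb' (hlt a ha)))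
  have := Finset.card_erase_add_one (S.min'_mem hne)
  omega

/-- Between two times at which single vertices copy a true `end` from `w`, the vertex `w`
sets its `end` to true. -/
theorem MMExecution.exists_rise_between_copies (E : MMExecution G m) {w x y : V}
    (hw : m w ≠ none) (hx : m x = none) (hxw : G.Adj x w) {i j : ℕ} (hij : i < j)
    (hpx : (E.cfg i).p x = some w) (hpw : (E.cfg i).p w = some x)
    (hex : (E.cfg (i + 1)).e x = true)
    (hpw' : (E.cfg j).p w = some y) (hew' : (E.cfg j).e w = true)
    (hey : (E.cfg j).e y = false) :
    ∃ k, i ≤ k ∧ k < j ∧ (E.cfg k).e w = false ∧ (E.cfg (k + 1)).e w = true := by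
  by_contra! hno
  have htrue := true_of_no_rise (f := fun k => (E.cfg k).e w) (i := i) hew'
    (fun k h1 h2 h3 => hno k h1 h2 h3.1 h3.2)
  have key : ∀ k, i + 1 ≤ k → k ≤ j →
      (E.cfg k).p w = some x ∧ (E.cfg k).p x = some w ∧ (E.cfg k).e x = true := by
    intro k hik
    induction k, hik using Nat.le_induction with
    | base =>
      intro hk
      have hM := E.movesOn i
      exact ⟨(hM.matched_p_eq hw (htrue _ (by omega) hk)).trans hpw,
        (hM.single_mutual hx hxw hw hpx hpw).1, hex⟩
    | succ k hk' ih =>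
      intro hk
      have hM := E.movesOn k
      obtain ⟨h1, h2, h3⟩ := ih (by omega)
      have h4 := hM.single_mutual hx hxw hw h2 h1
      refine ⟨(hM.matched_p_eq hw (htrue _ (by omega) hk)).trans h1, h4.1, ?_⟩
      rcases h4.2 with h5 | h5
      · exact h5.trans h3
      · exact h5.trans (htrue k (by omega) (by omega))
  obtain ⟨h1, -, h3⟩ := key j hij le_rfl
  obtain rfl : x = y := Option.some.inj (h1.symm.trans hpw')
  simp [hey] at h3

/-- The single vertices set `end` to true at most `3μ` times in total. -/
theorem MMExecution.sum_rises_single_le (hm : MaxMatchingOn G m) (E : MMExecution G m)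
    (N : ℕ) :
    ∑ x ∈ Finset.univ.filter (fun x => m x = none),
      (risesBefore (fun k => (E.cfg k).e x) N).card ≤ 3 * muV m := by
  rw [← Finset.card_sigma]
  set D := (Finset.univ.filter (fun x => m x = none)).sigma
    (fun x => risesBefore (fun k => (E.cfg k).e x) N) with hD
  have hspec : ∀ q ∈ D, m q.1 = none ∧ q.2 < N ∧ (E.cfg (q.2 + 1)).e q.1 = true ∧
      (E.cfg q.2).e q.1 = false ∧
      ∃ w, (E.cfg q.2).p q.1 = some w ∧ G.Adj q.1 w ∧ m w ≠ none ∧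
        (E.cfg q.2).p w = some q.1 ∧ (E.cfg q.2).e w = true := by
    intro q hq
    obtain ⟨h1, h2⟩ := Finset.mem_sigma.1 hq
    obtain ⟨h3, h4, h5⟩ := Finset.mem_filter.1 h2
    have hx := (Finset.mem_filter.1 h1).2
    exact ⟨hx, Finset.mem_range.1 h3, h5, h4, (E.movesOn q.2).single_rise hx h4 h5⟩
  have hcover : D ⊆ (Finset.univ.filter fun w => m w ≠ none).biUnion
      (fun w => D.filter fun q => (E.cfg q.2).p q.1 = some w) := by
    intro q hq
    obtain ⟨-, -, -, -, w, h1, -, h3, -⟩ := hspec q hq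
    exact Finset.mem_biUnion.2 ⟨w, by simp [h3], Finset.mem_filter.2 ⟨hq, h1⟩⟩
  have hfib : ∀ w ∈ Finset.univ.filter (fun w => m w ≠ none),
      (D.filter fun q => (E.cfg q.2).p q.1 = some w).card ≤ 3 := by
    intro w hw
    have hw := (Finset.mem_filter.1 hw).2
    set F := D.filter fun q => (E.cfg q.2).p q.1 = some w with hF
    have hFs : ∀ q ∈ F, m q.1 = none ∧ q.2 < N ∧ (E.cfg (q.2 + 1)).e q.1 = true ∧
        (E.cfg q.2).e q.1 = false ∧ (E.cfg q.2).p q.1 = some w ∧ G.Adj q.1 w ∧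
        (E.cfg q.2).p w = some q.1 ∧ (E.cfg q.2).e w = true := by
      intro q hq
      obtain ⟨hqD, hqw⟩ := Finset.mem_filter.1 hq
      obtain ⟨h1, h2, h3, h4, w', h5, h6, -, h8, h9⟩ := hspec q hqD
      obtain rfl : w = w' := Option.some.inj (hqw.symm.trans h5)
      exact ⟨h1, h2, h3, h4, h5, h6, h8, h9⟩
    have hinj : Set.InjOn (fun q : (_ : V) × ℕ => q.2) F := by
      rintro ⟨x, k⟩ hq ⟨y, l⟩ hr hkl
      obtain rfl : k = l := hkl
      obtain ⟨-, -, -, -, -, -, h1, -⟩ := hFs _ hq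
      obtain ⟨-, -, -, -, -, -, h2, -⟩ := hFs _ hr
      obtain rfl : x = y := Option.some.inj (h1.symm.trans h2)
      rfl
    rw [← Finset.card_image_of_injOn hinj]
    refine (card_le_card_add_one_of_separated
      (risesBefore (fun k => (E.cfg k).e w) N) _ ?_).trans
      (Nat.succ_le_succ (E.card_rises_matched_le hm hw N))
    intro i hi j hj hij
    obtain ⟨q, hq, rfl⟩ := Finset.mem_image.1 hi
    obtain ⟨r, hr, rfl⟩ := Finset.mem_image.1 hj
    obtain ⟨h1, -, h3, -, h5, h6, h7, -⟩ := hFs q hq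
    obtain ⟨-, k2, -, k4, -, -, k7, k8⟩ := hFs r hr
    obtain ⟨k, hk1, hk2, hk3⟩ :=
      E.exists_rise_between_copies hw h1 h6 hij h5 h7 h3 k7 k8 k4
    exact ⟨k, Finset.mem_filter.2 ⟨Finset.mem_range.2 (hk2.trans k2), hk3⟩, hk1, hk2⟩
  calc D.card ≤ _ := Finset.card_le_card hcover
    _ ≤ _ := Finset.card_biUnion_le
    _ ≤ ∑ w ∈ Finset.univ.filter (fun w => m w ≠ none), 3 := Finset.sum_le_sum hfib
    _ = 3 * muV m := by rw [Finset.sum_const, smul_eq_mul, mul_comm]; rfl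

/-- The single vertices change `end` at most `σ + 6μ` times in total. -/
theorem MMExecution.sum_changes_single_le (hm : MaxMatchingOn G m) (E : MMExecution G m)
    (N : ℕ) :
    ∑ x ∈ Finset.univ.filter (fun x => m x = none),
      (changesBefore (fun k => (E.cfg k).e x) N).card ≤ sigmaV m + 6 * muV m := by
  have h := E.sum_rises_single_le hm N
  calc _ ≤ ∑ x ∈ Finset.univ.filter (fun x => m x = none),
        (1 + 2 * (risesBefore (fun k => (E.cfg k).e x) N).card) :=
        Finset.sum_le_sum fun x _ => card_changesBefore_le _ _
    _ = sigmaV m + 2 * ∑ x ∈ Finset.univ.filter (fun x => m x = none),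
        (risesBefore (fun k => (E.cfg k).e x) N).card := by
      rw [Finset.sum_add_distrib, ← Finset.mul_sum, Finset.sum_const, smul_eq_mul, mul_one]
      rfl
    _ ≤ _ := by omega

/-- `BestRematch(u)` changes only if some single neighbor of `u` changes its `end`. -/
theorem MovesOn.bestRematch_eq {C C' : MMConfig V} {A : Set V} (h : MovesOn G m C C' A)
    {u : V} (he : ∀ x, G.Adj u x → m x = none → C.e x = C'.e x) :
    bestRematch G m C' u = bestRematch G m C u := by
  have hc : candSet G m C' u = candSet G m C u := by
    ext x
    simp only [candSet, Set.mem_ofPred_eq]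
    refine and_congr_right fun hux => and_congr_right fun hx => ?_
    have hex := he x hux hx
    cases hb : C'.e x
    · simp [hex, hb]
    · rw [h.single_p_eq hx hb, hex, hb]
  simp only [bestRematch, hc]

/-- Between two `Update` moves of `u`, some single neighbor of `u` changes its `end`. -/
theorem MMExecution.exists_change_between_updates (E : MMExecution G m) {u : V}
    (hu : m u ≠ none) {i j : ℕ} (hij : i < j) (hi : u ∈ E.act i)
    (hgi : guardUpdate G m (E.cfg i) u) (hgj : guardUpdate G m (E.cfg j) u) :
    ∃ x k, G.Adj u x ∧ m x = none ∧ i ≤ k ∧ k < j ∧ (E.cfg k).e x ≠ (E.cfg (k + 1)).e x := by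
  by_contra! hno
  obtain ⟨v, huv⟩ := Option.ne_none_iff_exists'.1 hu
  have hbest : ∀ k, i ≤ k → k < j →
      bestRematch G m (E.cfg (k + 1)) u = bestRematch G m (E.cfg k) u := fun k h1 h2 =>
    (E.movesOn k).bestRematch_eq fun x hux hx => hno x k hux hx h1 h2
  have key : ∀ k, i + 1 ≤ k → k ≤ j → ¬ guardUpdateA G m (E.cfg k) u ∧
      ((E.cfg k).a u, (E.cfg k).b u) = bestRematch G m (E.cfg k) u := by
    intro k hik
    induction k, hik using Nat.le_induction with
    | base =>
      intro hk
      refine ⟨(E.movesOn i).not_guardUpdateA hu (Or.inl hi), ?_⟩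
      rw [hbest i le_rfl hij]
      rcases (E.movesOn i).matched_cases huv hi with ⟨-, -, h, -⟩ | ⟨h, -⟩
      · exact h
      · exact absurd hgi h
    | succ k hk' ih =>
      intro hk
      obtain ⟨nA, hab⟩ := ih (by omega)
      refine ⟨(E.movesOn k).not_guardUpdateA hu (Or.inr nA), ?_⟩
      rw [hbest k (by omega) hk]
      by_cases hA : u ∈ E.act k
      · rcases (E.movesOn k).matched_cases huv hA with ⟨-, -, h, -⟩ | ⟨-, h2, h3, -⟩
        · exact h
        · rw [h2, h3, hab]
      · have hl := (E.movesOn k).same u hA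
        simp only [MMConfig.loc, MMLocal.mk.injEq] at hl
        rw [hl.2.1, hl.2.2.1, hab]
  obtain ⟨nA, hab⟩ := key j hij le_rfl
  rcases hgj with h | ⟨h, -⟩
  · exact nA h
  · exact h hab

end UpdateBound

/-- In any execution, matched vertices execute the `Update` rule at most
`Δ(σ + 6μ) + μ` times in total. -/
theorem stmt4 {V : Type*} [Fintype V] [LinearOrder V]
    (G : SimpleGraph V) (m : V → Option V) (hm : MaxMatchingOn G m)
    [DecidableRel G.Adj] (E : MMExecution G m) :
    ∀ T : Finset (ℕ × V),
      (∀ q ∈ T, m q.2 ≠ none ∧ q.2 ∈ E.act q.1 ∧ guardUpdate G m (E.cfg q.1) q.2) →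
      T.card ≤ G.maxDegree * (sigmaV m + 6 * muV m) + muV m := by
  intro T hT
  obtain ⟨N, hN⟩ : ∃ N, ∀ q ∈ T, q.1 < N :=
    ⟨T.sup Prod.fst + 1, fun q hq => Nat.lt_succ_of_le (Finset.le_sup (f := Prod.fst) hq)⟩
  set ch : V → Finset ℕ := fun x => changesBefore (fun k => (E.cfg k).e x) N with hch
  set single := Finset.univ.filter (fun x : V => m x = none) with hsingle
  set matched := Finset.univ.filter (fun u : V => m u ≠ none) with hmatched
  have hfib : ∀ u ∈ matched, (T.filter fun q => q.2 = u).card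
      ≤ (∑ x ∈ single.filter (fun x => G.Adj u x), (ch x).card) + 1 := by
    intro u hu
    have hu := (Finset.mem_filter.1 hu).2
    have hinj : Set.InjOn Prod.fst (↑(T.filter fun q => q.2 = u) : Set (ℕ × V)) := by
      intro q hq r hr hqr
      exact Prod.ext hqr ((Finset.mem_filter.1 hq).2.trans (Finset.mem_filter.1 hr).2.symm)
    rw [← Finset.card_image_of_injOn hinj]
    refine (card_le_card_add_one_of_separated
      ((single.filter fun x => G.Adj u x).biUnion ch) _ ?_).trans
      (Nat.succ_le_succ Finset.card_biUnion_le)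
    intro i hi j hj hij
    obtain ⟨q, hq, rfl⟩ := Finset.mem_image.1 hi
    obtain ⟨r, hr, rfl⟩ := Finset.mem_image.1 hj
    obtain ⟨hqT, rfl⟩ := Finset.mem_filter.1 hq
    obtain ⟨hrT, hru⟩ := Finset.mem_filter.1 hr
    obtain ⟨-, q2, q3⟩ := hT q hqT
    obtain ⟨-, -, r3⟩ := hT r hrT
    rw [hru] at r3
    obtain ⟨x, k, h1, h2, h3, h4, h5⟩ := E.exists_change_between_updates hu hij q2 q3 r3
    refine ⟨k, Finset.mem_biUnion.2 ⟨x, by simp [hsingle, h1, h2], ?_⟩, h3, h4⟩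
    exact Finset.mem_filter.2 ⟨Finset.mem_range.2 (h4.trans (hN r hrT)), h5⟩
  calc T.card = ∑ u ∈ matched, (T.filter fun q => q.2 = u).card :=
        Finset.card_eq_sum_card_fiberwise fun q hq => by
          simpa [hmatched] using (hT q hq).1
    _ ≤ ∑ u ∈ matched, ((∑ x ∈ single.filter (fun x => G.Adj u x), (ch x).card) + 1) :=
        Finset.sum_le_sum hfib
    _ = (∑ x ∈ single, ∑ u ∈ matched.filter (fun u => G.Adj u x), (ch x).card) + muV m := by
        rw [Finset.sum_add_distrib, Finset.sum_const, smul_eq_mul, mul_one]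
        simp only [Finset.sum_filter (s := single), Finset.sum_filter (s := matched)]
        rw [Finset.sum_comm]
        rfl
    _ ≤ (∑ x ∈ single, G.maxDegree * (ch x).card) + muV m := by
        refine Nat.add_le_add_right (Finset.sum_le_sum fun x _ => ?_) _
        rw [Finset.sum_const, smul_eq_mul]
        refine Nat.mul_le_mul_right _ (le_trans ?_ (G.degree_le_maxDegree x))
        rw [← G.card_neighborFinset_eq_degree]
        refine Finset.card_le_card fun u hu => ?_
        simpa using (Finset.mem_filter.1 hu).2.symm
    _ ≤ G.maxDegree * (sigmaV m + 6 * muV m) + muV m := by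
        rw [← Finset.mul_sum]
        exact Nat.add_le_add_right (Nat.mul_le_mul_left _ (E.sum_changes_single_le hm N)) _
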